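/- arXiv:2205.09914 — 5 statements merged into one kernel-verified Lean document; each statement's English description precedes it below -/
import Mathlib

section
/- Let Ω be a measurable space, P a probability measure on Ω, Z : Ω → ℝ a bounded measurable function, and ε > 0. Then the supremum of ∫ Z dQ over all probability measures Q on Ω that are absolutely continuous with respect to P and satisfy KL(Q ‖ P) ≤ ε equals the infimum over λ > 0 of λ·ε + λ·log(∫ exp(Z(ω)/λ) dP(ω)). -/
open MeasureTheory Real Classical
open scoped ENNReal

/-- The Kullback–Leibler divergence `KL(μ ‖ ν) = ∫ log (dμ/dν) dμ`, with value `∞`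
unless `μ` is absolutely continuous w.r.t. `ν` and the log-likelihood ratio is integrable. -/

noncomputable def klDiv {α : Type*} [MeasurableSpace α] (μ ν : Measure α) : ℝ≥0∞ :=
  if μ ≪ ν ∧ Integrable (llr μ ν) μ then ENNReal.ofReal (∫ x, llr μ ν x ∂μ) else ⊤

lemma klDiv_of_ac_of_integrable {α : Type*} [MeasurableSpace α] {μ ν : Measure α}
    (h : μ ≪ ν) (h_int : Integrable (llr μ ν) μ) :
    klDiv μ ν = ENNReal.ofReal (∫ x, llr μ ν x ∂μ) :=
  if_pos ⟨h, h_int⟩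

lemma ac_and_integrable_of_klDiv_ne_top {α : Type*} [MeasurableSpace α] {μ ν : Measure α}
    (h : klDiv μ ν ≠ ⊤) : μ ≪ ν ∧ Integrable (llr μ ν) μ := by
  by_contra hn
  exact h (if_neg hn)

lemma integral_llr_nonneg {α : Type*} [MeasurableSpace α] {μ ν : Measure α}
    [IsProbabilityMeasure μ] [IsProbabilityMeasure ν] (h : μ ≪ ν)
    (h_int : Integrable (llr μ ν) μ) : 0 ≤ ∫ x, llr μ ν x ∂μ := by
  simpa using InformationTheory.integral_llr_add_sub_measure_univ_nonneg h h_int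

lemma integrable_of_abs_le {α : Type*} [MeasurableSpace α] {μ : Measure α} [IsFiniteMeasure μ]
    {f : α → ℝ} (hf : Measurable f) {C : ℝ} (hC : ∀ x, |f x| ≤ C) : Integrable f μ :=
  .of_bound hf.aestronglyMeasurable C (.of_forall hC)

lemma integrable_exp_mul_of_abs_le {α : Type*} [MeasurableSpace α] {μ : Measure α}
    [IsFiniteMeasure μ] {f : α → ℝ} (hf : Measurable f) {C : ℝ} (hC : ∀ x, |f x| ≤ C) (t : ℝ) :
    Integrable (fun x ↦ exp (t * f x)) μ :=
  ProbabilityTheory.integrable_exp_mul_of_mem_Icc hf.aemeasurable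
    (.of_forall fun x ↦ abs_le.mp (hC x))

/-- The easy half of the Donsker–Varadhan variational formula. -/
lemma integral_le_integral_llr_add_log {α : Type*} [MeasurableSpace α] {μ ν : Measure α}
    [IsProbabilityMeasure μ] [IsProbabilityMeasure ν] (h : μ ≪ ν)
    (h_int : Integrable (llr μ ν) μ) {f : α → ℝ} (hfμ : Integrable f μ)
    (hfν : Integrable (fun x ↦ exp (f x)) ν) :
    ∫ x, f x ∂μ ≤ ∫ x, llr μ ν x ∂μ + log (∫ x, exp (f x) ∂ν) := by
  have := isProbabilityMeasure_tilted hfν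
  have h0 := integral_llr_nonneg (h.trans (absolutelyContinuous_tilted hfν))
    (integrable_llr_tilted_right h hfμ h_int hfν)
  rw [integral_llr_tilted_right h hfμ hfν h_int] at h0
  linarith

lemma llr_tilted_self_ae {α : Type*} [MeasurableSpace α] {μ : Measure α} [SigmaFinite μ]
    {f : α → ℝ} (hf : Integrable (fun x ↦ exp (f x)) μ) :
    llr (μ.tilted f) μ =ᵐ[μ.tilted f] fun x ↦ f x - log (∫ x, exp (f x) ∂μ) :=
  (tilted_absolutelyContinuous μ f).ae_le (log_rnDeriv_tilted_left_self hf)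

lemma integrable_llr_tilted_self {α : Type*} [MeasurableSpace α] {μ : Measure α}
    [IsProbabilityMeasure μ] {f : α → ℝ} (hf : Integrable (fun x ↦ exp (f x)) μ)
    (hfint : Integrable f (μ.tilted f)) : Integrable (llr (μ.tilted f) μ) (μ.tilted f) := by
  have := isProbabilityMeasure_tilted hf
  rw [integrable_congr (llr_tilted_self_ae hf)]
  exact hfint.sub (integrable_const _)

lemma integral_llr_tilted_self {α : Type*} [MeasurableSpace α] {μ : Measure α}
    [IsProbabilityMeasure μ] {f : α → ℝ} (hf : Integrable (fun x ↦ exp (f x)) μ)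
    (hfint : Integrable f (μ.tilted f)) :
    ∫ x, llr (μ.tilted f) μ x ∂(μ.tilted f) =
      ∫ x, f x ∂(μ.tilted f) - log (∫ x, exp (f x) ∂μ) := by
  have := isProbabilityMeasure_tilted hf
  rw [integral_congr_ae (llr_tilted_self_ae hf), integral_sub hfint (integrable_const _)]
  simp

lemma integral_le_dual_of_klDiv_le {α : Type*} [MeasurableSpace α] {μ ν : Measure α}
    [IsProbabilityMeasure μ] [IsProbabilityMeasure ν] {f : α → ℝ} (hf : Measurable f) {C : ℝ}
    (hC : ∀ x, |f x| ≤ C) {ε : ℝ} (hε : 0 ≤ ε) (hkl : klDiv μ ν ≤ ENNReal.ofReal ε)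
    {l : ℝ} (hl : 0 < l) :
    ∫ x, f x ∂μ ≤ l * ε + l * log (∫ x, exp (f x / l) ∂ν) := by
  obtain ⟨hac, hint⟩ := ac_and_integrable_of_klDiv_ne_top (ne_top_of_le_ne_top (by simp) hkl)
  rw [klDiv_of_ac_of_integrable hac hint, ENNReal.ofReal_le_ofReal_iff hε] at hkl
  have hexp : Integrable (fun x ↦ exp (f x / l)) ν := by
    simpa only [div_eq_inv_mul] using integrable_exp_mul_of_abs_le hf hC l⁻¹
  have h := integral_le_integral_llr_add_log hac hint
    ((integrable_of_abs_le hf hC).div_const l) hexp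
  rw [integral_div, div_le_iff₀ hl] at h
  nlinarith

/-- The divergence from `μ` of the tilted measure `μ.tilted (t * f ·)`, expressed through the
cumulant generating function, is continuous in `t` when `f` is bounded. -/
lemma continuous_mul_deriv_cgf_sub_cgf {α : Type*} [MeasurableSpace α] {μ : Measure α}
    {f : α → ℝ} (hf : ProbabilityTheory.integrableExpSet f μ = Set.univ) :
    Continuous fun t ↦ t * deriv (ProbabilityTheory.cgf f μ) t - ProbabilityTheory.cgf f μ t := by
  have han : AnalyticOnNhd ℝ (ProbabilityTheory.cgf f μ) Set.univ := by
    simpa [hf] using ProbabilityTheory.analyticOnNhd_cgf (X := f) (μ := μ)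
  have hc := continuousOn_univ.mp han.continuousOn
  have hd := continuousOn_univ.mp han.deriv.continuousOn
  fun_prop

/-- Some exponential tilt of `ν` lies in the ambiguity set and closes the duality gap
up to `δ`. -/
lemma exists_klDiv_le_dual_le_integral_add {α : Type*} [MeasurableSpace α] {ν : Measure α}
    [IsProbabilityMeasure ν] {f : α → ℝ} (hf : Measurable f) {C : ℝ}
    (hC : ∀ x, |f x| ≤ C) {ε : ℝ} (hε : 0 < ε) {δ : ℝ} (hδ : 0 < δ) :
    ∃ μ : Measure α, IsProbabilityMeasure μ ∧ μ ≪ ν ∧ klDiv μ ν ≤ ENNReal.ofReal ε ∧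
      ∃ l : ℝ, 0 < l ∧ l * ε + l * log (∫ x, exp (f x / l) ∂ν) ≤ ∫ x, f x ∂μ + δ := by
  have hexp (t : ℝ) : Integrable (fun x ↦ exp (t * f x)) ν := integrable_exp_mul_of_abs_le hf hC t
  have hset : ProbabilityTheory.integrableExpSet f ν = Set.univ :=
    Set.eq_univ_of_forall fun t ↦ hexp t
  have hprob (t : ℝ) : IsProbabilityMeasure (ν.tilted (t * f ·)) :=
    isProbabilityMeasure_tilted (hexp t)
  have hfint (t : ℝ) : Integrable (t * f ·) (ν.tilted (t * f ·)) :=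
    (integrable_of_abs_le hf hC).const_mul t
  have hmean (t : ℝ) : ∫ x, f x ∂(ν.tilted (t * f ·)) = deriv (ProbabilityTheory.cgf f ν) t :=
    ProbabilityTheory.integral_tilted_mul_self (by simp [hset])
  have hllr (t : ℝ) : ∫ x, llr (ν.tilted (t * f ·)) ν x ∂(ν.tilted (t * f ·)) =
      t * deriv (ProbabilityTheory.cgf f ν) t - ProbabilityTheory.cgf f ν t := by
    rw [integral_llr_tilted_self (hexp t) (hfint t), integral_const_mul, hmean]
    rfl
  have hnonneg (t : ℝ) :
      0 ≤ t * deriv (ProbabilityTheory.cgf f ν) t - ProbabilityTheory.cgf f ν t :=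
    hllr t ▸ integral_llr_nonneg (tilted_absolutelyContinuous _ _)
      (integrable_llr_tilted_self (hexp t) (hfint t))
  suffices h : ∃ t, 0 < t ∧
      t * deriv (ProbabilityTheory.cgf f ν) t - ProbabilityTheory.cgf f ν t ≤ ε ∧
      ε - (t * deriv (ProbabilityTheory.cgf f ν) t - ProbabilityTheory.cgf f ν t) ≤ t * δ by
    obtain ⟨t, ht, hle, hgap⟩ := h
    refine ⟨ν.tilted (t * f ·), hprob t, tilted_absolutelyContinuous _ _, ?_, t⁻¹,
      inv_pos.mpr ht, ?_⟩
    · rw [klDiv_of_ac_of_integrable (tilted_absolutelyContinuous _ _)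
        (integrable_llr_tilted_self (hexp t) (hfint t)), hllr]
      exact ENNReal.ofReal_le_ofReal hle
    · have hlog : log (∫ x, exp (f x / t⁻¹) ∂ν) = ProbabilityTheory.cgf f ν t := by
        simp only [div_inv_eq_mul, mul_comm _ t]
        rfl
      rw [hlog, hmean, ← mul_add, inv_mul_le_iff₀ ht]
      linarith
  have hT : 0 < ε / δ := div_pos hε hδ
  rcases le_total (ε / δ * deriv (ProbabilityTheory.cgf f ν) (ε / δ) -
    ProbabilityTheory.cgf f ν (ε / δ)) ε with h | h
  · refine ⟨ε / δ, hT, h, ?_⟩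
    rw [div_mul_cancel₀ _ hδ.ne']
    linarith [hnonneg (ε / δ)]
  · obtain ⟨t, ht, heq⟩ := intermediate_value_Icc hT.le
      (continuous_mul_deriv_cgf_sub_cgf hset).continuousOn
      (show ε ∈ Set.Icc _ _ from ⟨by simpa using hε.le, h⟩)
    have ht0 : 0 < t := by
      refine ht.1.lt_of_ne ?_
      rintro rfl
      simp [hε.ne] at heq
    refine ⟨t, ht0, heq.le, ?_⟩
    have : 0 ≤ t * δ := by positivity
    simp only at heq
    linarith

/-- Duality for maximization of an affine functional over a KL-divergence ambiguity set:
`sup_{Q ≪ P, KL(Q‖P) ≤ ε} ∫ Z dQ = inf_{λ > 0} (λ ε + λ log ∫ exp(Z/λ) dP)`. -/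
theorem sup_ambiguity_eq_inf_dual
    {Ω : Type*} [MeasurableSpace Ω] (P : Measure Ω) [IsProbabilityMeasure P]
    (Z : Ω → ℝ) (hZmeas : Measurable Z) (C : ℝ) (hZbdd : ∀ ω, |Z ω| ≤ C)
    (ε : ℝ) (hε : 0 < ε) :
    sSup {r : ℝ | ∃ Q : Measure Ω, IsProbabilityMeasure Q ∧ Q ≪ P ∧
        klDiv Q P ≤ ENNReal.ofReal ε ∧ r = ∫ ω, Z ω ∂Q} =
    sInf {r : ℝ | ∃ l : ℝ, 0 < l ∧
        r = l * ε + l * Real.log (∫ ω, Real.exp (Z ω / l) ∂P)} := by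
  have hweak : ∀ r ∈ {r : ℝ | ∃ Q : Measure Ω, IsProbabilityMeasure Q ∧ Q ≪ P ∧
      klDiv Q P ≤ ENNReal.ofReal ε ∧ r = ∫ ω, Z ω ∂Q}, ∀ s ∈ {r : ℝ | ∃ l : ℝ, 0 < l ∧
        r = l * ε + l * Real.log (∫ ω, Real.exp (Z ω / l) ∂P)}, r ≤ s := by
    rintro _ ⟨Q, _, -, hkl, rfl⟩ _ ⟨l, hl, rfl⟩
    exact integral_le_dual_of_klDiv_le hZmeas hZbdd hε.le hkl hl
  obtain ⟨Q₀, hQ₀, hac₀, hkl₀, l₀, hl₀, -⟩ :=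
    exists_klDiv_le_dual_le_integral_add (ν := P) hZmeas hZbdd hε one_pos
  apply le_antisymm
  · exact csSup_le ⟨_, Q₀, hQ₀, hac₀, hkl₀, rfl⟩ fun r hr ↦
      le_csInf ⟨_, l₀, hl₀, rfl⟩ (hweak r hr)
  · refine le_of_forall_pos_le_add fun δ hδ ↦ ?_
    obtain ⟨Q, hQ, hac, hkl, l, hl, hgap⟩ :=
      exists_klDiv_le_dual_le_integral_add (ν := P) hZmeas hZbdd hε hδ
    have hinf := csInf_le ⟨_, hweak _ ⟨Q₀, hQ₀, hac₀, hkl₀, rfl⟩⟩ ⟨l, hl, rfl⟩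
    have hsup := le_csSup ⟨_, fun r hr ↦ hweak r hr _ ⟨l₀, hl₀, rfl⟩⟩ ⟨Q, hQ, hac, hkl, rfl⟩
    exact hinf.trans (hgap.trans (by gcongr))
end

section
/- Let Ω be a measurable space, P a probability measure on Ω, Z : Ω → ℝ a bounded measurable function, and ε > 0. Then the infimum of ∫ Z dQ over all probability measures Q on Ω that are absolutely continuous with respect to P and satisfy KL(Q ‖ P) ≤ ε equals the negative of the infimum over λ > 0 of λ·ε + λ·log(∫ exp(−Z(ω)/λ) dP(ω)). -/
open MeasureTheory Real Classical
open scoped ENNReal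

/-- A bounded measurable function has exponential moments of all orders. -/
lemma integrable_exp_mul_of_bounded {Ω : Type*} [MeasurableSpace Ω] (P : Measure Ω)
    [IsFiniteMeasure P] {X : Ω → ℝ} (hX : Measurable X) {C : ℝ} (hC : ∀ ω, |X ω| ≤ C) (t : ℝ) :
    Integrable (fun ω ↦ exp (t * X ω)) P := by
  refine .of_bound (by fun_prop) (exp (|t| * C)) (.of_forall fun ω ↦ ?_)
  rw [norm_of_nonneg (exp_pos _).le, exp_le_exp]
  calc t * X ω ≤ |t * X ω| := le_abs_self _
    _ = |t| * |X ω| := abs_mul _ _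
    _ ≤ |t| * C := by gcongr; exact hC ω

/-- The **Donsker–Varadhan inequality**: the easy half of the Gibbs variational principle. -/
lemma integral_le_integral_llr_add_log_integral_exp {Ω : Type*} [MeasurableSpace Ω]
    {Q P : Measure Ω} [IsProbabilityMeasure Q] [IsProbabilityMeasure P] {f : Ω → ℝ}
    (hQP : Q ≪ P) (hllr : Integrable (llr Q P) Q) (hfQ : Integrable f Q)
    (hfP : Integrable (fun ω ↦ exp (f ω)) P) :
    ∫ ω, f ω ∂Q ≤ ∫ ω, llr Q P ω ∂Q + log (∫ ω, exp (f ω) ∂P) := by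
  have := isProbabilityMeasure_tilted hfP
  have h := InformationTheory.integral_llr_add_sub_measure_univ_nonneg
    (hQP.trans (absolutelyContinuous_tilted hfP))
    (integrable_llr_tilted_right hQP hfQ hllr hfP)
  rw [integral_llr_tilted_right hQP hfQ hfP hllr] at h
  simp only [probReal_univ] at h
  linarith

/-- The log-likelihood ratio of an exponential tilting with respect to the original measure is
integrable, and its mean is the mean of the tilt minus the log-partition function. -/
lemma integral_llr_tilted_left_self {Ω : Type*} [MeasurableSpace Ω] {P : Measure Ω}
    [IsProbabilityMeasure P] {f : Ω → ℝ} (hfP : Integrable (fun ω ↦ exp (f ω)) P)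
    (hf : Integrable f (P.tilted f)) :
    Integrable (llr (P.tilted f) P) (P.tilted f) ∧
      ∫ ω, llr (P.tilted f) P ω ∂(P.tilted f)
        = ∫ ω, f ω ∂(P.tilted f) - log (∫ ω, exp (f ω) ∂P) := by
  have := isProbabilityMeasure_tilted hfP
  have hllr : llr (P.tilted f) P =ᵐ[P.tilted f] fun ω ↦ f ω - log (∫ x, exp (f x) ∂P) :=
    (tilted_absolutelyContinuous P f).ae_le (log_rnDeriv_tilted_left_self hfP)
  refine ⟨(integrable_congr hllr).2 (hf.sub (integrable_const _)), ?_⟩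
  rw [integral_congr_ae hllr, integral_sub hf (integrable_const _)]
  simp

/-- Along the exponential family generated by `X`, there are parameters `t > 0` at which the
slack `ε - (t Λ'(t) - Λ(t))`, with `Λ` the cumulant generating function, is nonnegative and
at most `t * η`. -/
lemma exists_pos_cgf_slack_le {Ω : Type*} [MeasurableSpace Ω] {P : Measure Ω}
    [IsProbabilityMeasure P] {X : Ω → ℝ} (hX : Measurable X) {C : ℝ} (hC : ∀ ω, |X ω| ≤ C)
    {ε : ℝ} (hε : 0 < ε) {η : ℝ} (hη : 0 < η)
    (hkl : ∀ t, 0 ≤ t * deriv (ProbabilityTheory.cgf X P) t - ProbabilityTheory.cgf X P t) :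
    ∃ t, 0 < t ∧
      t * deriv (ProbabilityTheory.cgf X P) t - ProbabilityTheory.cgf X P t ≤ ε ∧
      ε ≤ t * deriv (ProbabilityTheory.cgf X P) t - ProbabilityTheory.cgf X P t + t * η := by
  have huniv : interior (ProbabilityTheory.integrableExpSet X P) = Set.univ := by
    rw [Set.eq_univ_of_forall (s := ProbabilityTheory.integrableExpSet X P)
      fun t ↦ integrable_exp_mul_of_bounded P hX hC t, interior_univ]
  have han : AnalyticOnNhd ℝ (ProbabilityTheory.cgf X P) Set.univ :=
    huniv ▸ ProbabilityTheory.analyticOnNhd_cgf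
  have hcont : Continuous fun t ↦
      t * deriv (ProbabilityTheory.cgf X P) t - ProbabilityTheory.cgf X P t :=
    (continuous_id.mul (continuousOn_univ.1 han.deriv.continuousOn)).sub
      (continuousOn_univ.1 han.continuousOn)
  have hpos : 0 < ε / η := by positivity
  rcases le_total (ε / η * deriv (ProbabilityTheory.cgf X P) (ε / η)
    - ProbabilityTheory.cgf X P (ε / η)) ε with h | h
  · refine ⟨ε / η, hpos, h, ?_⟩
    have := hkl (ε / η)
    rw [div_mul_cancel₀ ε hη.ne']
    linarith
  · obtain ⟨t, ht, hte⟩ := intermediate_value_Icc hpos.le hcont.continuousOn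
      (show ε ∈ Set.Icc _ _ from ⟨by simpa using hε.le, h⟩)
    have ht0 : 0 < t := by
      refine ht.1.lt_of_ne fun h0 ↦ hε.ne ?_
      simpa [← h0] using hte
    have := mul_pos ht0 hη
    exact ⟨t, ht0, hte.le, by simp only at hte; linarith⟩

/-- If `-b ≤ a` for all `a ∈ A`, `b ∈ B` and the gap can be made arbitrarily small, then
`sInf A = - sInf B`. -/
lemma Real.sInf_eq_neg_sInf_of_forall_exists_le_add {A B : Set ℝ}
    (hweak : ∀ a ∈ A, ∀ b ∈ B, -b ≤ a)
    (hstrong : ∀ η > 0, ∃ a ∈ A, ∃ b ∈ B, a ≤ -b + η) : sInf A = -sInf B := by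
  obtain ⟨a₀, ha₀, b₀, hb₀, -⟩ := hstrong 1 one_pos
  have hA : BddBelow A := ⟨-b₀, fun a ha ↦ hweak a ha b₀ hb₀⟩
  have hB : BddBelow B := ⟨-a₀, fun b hb ↦ neg_le.1 (hweak a₀ ha₀ b hb)⟩
  apply le_antisymm
  · refine le_of_forall_pos_le_add fun η hη ↦ ?_
    obtain ⟨a, ha, b, hb, hab⟩ := hstrong η hη
    linarith [csInf_le hA ha, csInf_le hB hb]
  · refine le_csInf ⟨a₀, ha₀⟩ fun a ha ↦ neg_le.1 (le_csInf ⟨b₀, hb₀⟩ fun b hb ↦ ?_)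
    exact neg_le.1 (hweak a ha b hb)

/-- Duality for minimization of an affine functional over a KL-divergence ambiguity set:
`inf_{Q ≪ P, KL(Q‖P) ≤ ε} ∫ Z dQ = - inf_{λ > 0} (λ ε + λ log ∫ exp(-Z/λ) dP)`. -/
theorem inf_ambiguity_eq_neg_inf_dual
    {Ω : Type*} [MeasurableSpace Ω] (P : Measure Ω) [IsProbabilityMeasure P]
    (Z : Ω → ℝ) (hZmeas : Measurable Z) (C : ℝ) (hZbdd : ∀ ω, |Z ω| ≤ C)
    (ε : ℝ) (hε : 0 < ε) :
    sInf {r : ℝ | ∃ Q : Measure Ω, IsProbabilityMeasure Q ∧ Q ≪ P ∧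
        klDiv Q P ≤ ENNReal.ofReal ε ∧ r = ∫ ω, Z ω ∂Q} =
    - sInf {r : ℝ | ∃ l : ℝ, 0 < l ∧
        r = l * ε + l * Real.log (∫ ω, Real.exp (-Z ω / l) ∂P)} := by
  let X : Ω → ℝ := fun ω ↦ -Z ω
  have hX : Measurable X := hZmeas.neg
  have hC : ∀ ω, |X ω| ≤ C := fun ω ↦ (abs_neg (Z ω)).trans_le (hZbdd ω)
  have hexp := integrable_exp_mul_of_bounded P hX hC
  have hint (Q : Measure Ω) [IsProbabilityMeasure Q] : Integrable X Q :=
    .of_bound hX.aestronglyMeasurable C (.of_forall hC)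
  have hZX (Q : Measure Ω) : ∫ ω, Z ω ∂Q = -∫ ω, X ω ∂Q := by simp [X, integral_neg]
  have hdual (l : ℝ) : Real.log (∫ ω, Real.exp (-Z ω / l) ∂P) = ProbabilityTheory.cgf X P l⁻¹ := by
    simp only [ProbabilityTheory.cgf, ProbabilityTheory.mgf, X, div_eq_inv_mul]
  refine Real.sInf_eq_neg_sInf_of_forall_exists_le_add ?_ fun η hη ↦ ?_
  · rintro _ ⟨Q, hQ, hQP, hkl, rfl⟩ _ ⟨l, hl, rfl⟩
    rw [klDiv] at hkl
    split_ifs at hkl with h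
    · have hkl' := (ENNReal.ofReal_le_ofReal_iff hε.le).1 hkl
      have hDV := integral_le_integral_llr_add_log_integral_exp hQP h.2
        ((hint Q).const_mul l⁻¹) (hexp l⁻¹)
      rw [integral_const_mul, inv_mul_le_iff₀ hl] at hDV
      have := mul_le_mul_of_nonneg_left hkl' hl.le
      rw [hZX, hdual]
      simp only [ProbabilityTheory.cgf, ProbabilityTheory.mgf]
      linarith
    · simp at hkl
  · have hprob (t : ℝ) : IsProbabilityMeasure (P.tilted (t * X ·)) :=
      isProbabilityMeasure_tilted (hexp t)
    have hmean (t : ℝ) :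
        ∫ ω, X ω ∂(P.tilted (t * X ·)) = deriv (ProbabilityTheory.cgf X P) t := by
      refine ProbabilityTheory.integral_tilted_mul_self ?_
      rw [Set.eq_univ_of_forall (s := ProbabilityTheory.integrableExpSet X P) hexp, interior_univ]
      trivial
    have hllr (t : ℝ) : Integrable (llr (P.tilted (t * X ·)) P) (P.tilted (t * X ·)) ∧
        ∫ ω, llr (P.tilted (t * X ·)) P ω ∂(P.tilted (t * X ·))
          = t * deriv (ProbabilityTheory.cgf X P) t - ProbabilityTheory.cgf X P t := by
      have h := integral_llr_tilted_left_self (hexp t) ((hint _).const_mul t)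
      rwa [integral_const_mul, hmean] at h
    have hkl (t : ℝ) : 0 ≤ t * deriv (ProbabilityTheory.cgf X P) t
        - ProbabilityTheory.cgf X P t := by
      have h := InformationTheory.integral_llr_add_sub_measure_univ_nonneg
        (tilted_absolutelyContinuous P _) (hllr t).1
      simpa [(hllr t).2] using h
    obtain ⟨t, ht, hle, hge⟩ := exists_pos_cgf_slack_le hX hC hε hη hkl
    refine ⟨_, ⟨P.tilted (t * X ·), hprob t, tilted_absolutelyContinuous _ _, ?_, rfl⟩,
      _, ⟨t⁻¹, inv_pos.2 ht, rfl⟩, ?_⟩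
    · rw [klDiv, if_pos ⟨tilted_absolutelyContinuous P _, (hllr t).1⟩, (hllr t).2]
      exact ENNReal.ofReal_le_ofReal hle
    · rw [hZX, hmean, hdual, inv_inv, ← mul_add, neg_add_eq_sub, neg_le_sub_iff_le_add,
        inv_mul_le_iff₀ ht]
      linarith
end

section
/- Let Θ and 𝒴 be measurable spaces, κ a Markov kernel from Θ to 𝒴, and p, q probability measures on Θ with q absolutely continuous with respect to p. If the affine approximation I_aff(q;p) = ∫ KL(κ(θ) ‖ p∘κ) dq(θ) is finite, then it decomposes as I_aff(q;p) = I(q) + KL(q∘κ ‖ p∘κ), where I(q) = ∫ KL(κ(θ) ‖ q∘κ) dq(θ); in particular I_aff(p;p) = I(p). -/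
open MeasureTheory ProbabilityTheory Real Classical
open scoped ENNReal

/-- The marginal `q∘κ` on `𝒴` of a prior `q` on `Θ` under the likelihood kernel `κ`,
given by `(q∘κ)(A) = ∫ κ(θ)(A) dq(θ)`. -/
noncomputable def marg {Θ 𝒴 : Type*} [MeasurableSpace Θ] [MeasurableSpace 𝒴]
    (κ : Kernel Θ 𝒴) (q : Measure Θ) : Measure 𝒴 :=
  q.bind κ

/-- The expected information gain of prior `q`: `I(q) = ∫ KL(κ(θ) ‖ q∘κ) dq(θ)`. -/
noncomputable def EIG {Θ 𝒴 : Type*} [MeasurableSpace Θ] [MeasurableSpace 𝒴]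
    (κ : Kernel Θ 𝒴) (q : Measure Θ) : ℝ≥0∞ :=
  ∫⁻ θ, klDiv (κ θ) (marg κ q) ∂q

/-- The affine approximation of the expected information gain at reference prior `p`:
`I_aff(q;p) = ∫ KL(κ(θ) ‖ p∘κ) dq(θ)`. -/
noncomputable def EIGaff {Θ 𝒴 : Type*} [MeasurableSpace Θ] [MeasurableSpace 𝒴]
    (κ : Kernel Θ 𝒴) (q p : Measure Θ) : ℝ≥0∞ :=
  ∫⁻ θ, klDiv (κ θ) (marg κ p) ∂q

section KLDivergence

variable {α : Type*} [MeasurableSpace α]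

lemma lintegral_ofReal_neg_llr_ne_top (μ ν : Measure α) [IsProbabilityMeasure μ]
    [IsProbabilityMeasure ν] (hμν : μ ≪ ν) : ∫⁻ x, ENNReal.ofReal (-llr μ ν x) ∂μ ≠ ∞ := by
  have hmeas : Measurable fun x ↦ ENNReal.ofReal (-llr μ ν x) :=
    (measurable_llr μ ν).neg.ennreal_ofReal
  rw [← lintegral_rnDeriv_mul hμν hmeas.aemeasurable]
  refine ne_top_of_le_ne_top (b := ∫⁻ _, 1 ∂ν) (by simp) (lintegral_mono_ae ?_)
  filter_upwards [μ.rnDeriv_lt_top ν] with x hx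
  rw [← ENNReal.ofReal_toReal hx.ne, ← ENNReal.ofReal_mul ENNReal.toReal_nonneg, llr_def,
    ← ENNReal.ofReal_one]
  refine ENNReal.ofReal_le_ofReal ?_
  have h := InformationTheory.klFun_nonneg (ENNReal.toReal_nonneg (a := μ.rnDeriv ν x))
  rw [InformationTheory.klFun_apply] at h
  nlinarith [ENNReal.toReal_nonneg (a := μ.rnDeriv ν x)]

/-- The divergence is the integral of the positive part of the log-likelihood ratio minus that of
its negative part; written additively this needs no integrability assumption. -/
lemma klDiv_add_lintegral_ofReal_neg_llr (μ ν : Measure α) [IsProbabilityMeasure μ]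
    [IsProbabilityMeasure ν] (hμν : μ ≪ ν) :
    klDiv μ ν + ∫⁻ x, ENNReal.ofReal (-llr μ ν x) ∂μ = ∫⁻ x, ENNReal.ofReal (llr μ ν x) ∂μ := by
  have hneg := lintegral_ofReal_neg_llr_ne_top μ ν hμν
  by_cases hint : Integrable (llr μ ν) μ
  · have hpos : ∫⁻ x, ENNReal.ofReal (llr μ ν x) ∂μ ≠ ∞ := hint.lintegral_lt_top.ne
    have hnonneg := InformationTheory.integral_llr_add_sub_measure_univ_nonneg hμν hint
    simp only [probReal_univ, add_sub_cancel_right] at hnonneg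
    rw [klDiv, if_pos ⟨hμν, hint⟩, ← ENNReal.ofReal_toReal hneg,
      ← ENNReal.ofReal_add hnonneg ENNReal.toReal_nonneg,
      integral_eq_lintegral_pos_part_sub_lintegral_neg_part hint, sub_add_cancel,
      ENNReal.ofReal_toReal hpos]
  · rw [klDiv, if_neg fun h ↦ hint h.2, top_add]
    by_contra hpos
    refine hint ⟨(measurable_llr μ ν).aestronglyMeasurable, ?_⟩
    have henorm (x : α) : ‖llr μ ν x‖ₑ
        = ENNReal.ofReal (llr μ ν x) + ENNReal.ofReal (-llr μ ν x) := by
      rw [Real.enorm_eq_ofReal_abs]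
      rcases le_total 0 (llr μ ν x) with h | h
      · simp [abs_of_nonneg h, ENNReal.ofReal_of_nonpos (neg_nonpos.mpr h)]
      · simp [abs_of_nonpos h, ENNReal.ofReal_of_nonpos h]
    simp only [HasFiniteIntegral, henorm]
    rw [lintegral_add_left (measurable_llr μ ν).ennreal_ofReal]
    exact ENNReal.add_lt_top.mpr ⟨Ne.lt_top' hpos, hneg.lt_top⟩

lemma absolutelyContinuous_of_ae_rnDeriv_ne_zero {μ ν ρ : Measure α} [SigmaFinite ν]
    [SigmaFinite ρ] (hμρ : μ ≪ ρ) (hνρ : ν ≪ ρ) (h : ∀ᵐ x ∂μ, ν.rnDeriv ρ x ≠ 0) : μ ≪ ν := by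
  intro s hs
  rw [← Measure.withDensity_rnDeriv_eq ν ρ hνρ,
    withDensity_apply_eq_zero (Measure.measurable_rnDeriv ν ρ)] at hs
  rw [← measure_inter_add_sdiff₀ s (Measure.measurable_rnDeriv ν ρ
    (measurableSet_singleton 0)).compl.nullMeasurableSet]
  refine add_eq_zero.mpr ⟨?_, measure_mono_null (fun x hx ↦ ?_) h⟩
  · rw [Set.inter_comm]
    exact hμρ hs
  · simpa using hx.2

lemma llr_add_llr {μ ν ρ : Measure α} [SigmaFinite μ] [SigmaFinite ν] [SigmaFinite ρ]
    (hμν : μ ≪ ν) (hνρ : ν ≪ ρ) :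
    ∀ᵐ x ∂μ, llr μ ρ x = llr μ ν x + llr ν ρ x := by
  have hμρ := hμν.trans hνρ
  filter_upwards [hμρ.ae_le (Measure.rnDeriv_mul_rnDeriv (κ := ρ) hμν), Measure.rnDeriv_pos hμν,
    hμν.ae_le (Measure.rnDeriv_pos hνρ), hμν.ae_le (μ.rnDeriv_lt_top ν),
    hμρ.ae_le (ν.rnDeriv_lt_top ρ)] with x hmul hpos₁ hpos₂ htop₁ htop₂
  simp only [llr_def]
  rw [← hmul, Pi.mul_apply, ENNReal.toReal_mul,
    Real.log_mul (ENNReal.toReal_pos hpos₁.ne' htop₁.ne).ne'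
      (ENNReal.toReal_pos hpos₂.ne' htop₂.ne).ne']

/-- Change of reference measure in the divergence, valid also for infinite values. -/
lemma klDiv_add_lintegral_ofReal_neg_llr_eq {μ ν ρ : Measure α} [IsProbabilityMeasure μ]
    [IsProbabilityMeasure ν] [IsProbabilityMeasure ρ] (hνρ : ν ≪ ρ)
    (h : ∀ᵐ x ∂μ, ν.rnDeriv ρ x ≠ 0) :
    klDiv μ ρ + ∫⁻ x, ENNReal.ofReal (-llr ν ρ x) ∂μ
      = klDiv μ ν + ∫⁻ x, ENNReal.ofReal (llr ν ρ x) ∂μ := by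
  by_cases hμρ : μ ≪ ρ
  swap
  · rw [klDiv, klDiv, if_neg fun h' ↦ hμρ h'.1, if_neg fun h' ↦ hμρ (h'.1.trans hνρ), top_add,
      top_add]
  have hμν := absolutelyContinuous_of_ae_rnDeriv_ne_zero hμρ hνρ h
  have hsplit : ∫⁻ x, ENNReal.ofReal (llr μ ρ x) ∂μ + ∫⁻ x, ENNReal.ofReal (-llr μ ν x) ∂μ
        + ∫⁻ x, ENNReal.ofReal (-llr ν ρ x) ∂μ
      = ∫⁻ x, ENNReal.ofReal (-llr μ ρ x) ∂μ + ∫⁻ x, ENNReal.ofReal (llr μ ν x) ∂μ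
        + ∫⁻ x, ENNReal.ofReal (llr ν ρ x) ∂μ := by
    rw [← lintegral_add_left (by fun_prop), ← lintegral_add_left (by fun_prop),
      ← lintegral_add_left (by fun_prop), ← lintegral_add_left (by fun_prop)]
    refine lintegral_congr_ae ?_
    filter_upwards [llr_add_llr hμν hνρ] with x hx
    simp only [ENNReal.ofReal]
    norm_cast
    rw [← NNReal.coe_inj]
    push_cast [Real.coe_toNNReal']
    rw [hx]
    have hparts (a : ℝ) : max a 0 - max (-a) 0 = a := max_zero_sub_max_neg_zero_eq_self a
    linarith [hparts (llr μ ν x + llr ν ρ x), hparts (llr μ ν x), hparts (llr ν ρ x)]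
  rw [← klDiv_add_lintegral_ofReal_neg_llr μ ρ hμρ,
    ← klDiv_add_lintegral_ofReal_neg_llr μ ν hμν] at hsplit
  have hfin := ENNReal.add_ne_top.mpr ⟨lintegral_ofReal_neg_llr_ne_top μ ρ hμρ,
    lintegral_ofReal_neg_llr_ne_top μ ν hμν⟩
  refine (ENNReal.add_left_inj hfin).mp ?_
  convert hsplit using 1 <;> ring

end KLDivergence

/-- Decomposition of the affine EIG approximation: if `I_aff(q;p)` is finite then
`I_aff(q;p) = I(q) + KL(q∘κ ‖ p∘κ)`; in particular `I_aff(p;p) = I(p)`. -/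
theorem eigAff_eq_eig_add_klDiv_marg
    {Θ 𝒴 : Type*} [MeasurableSpace Θ] [MeasurableSpace 𝒴]
    (κ : Kernel Θ 𝒴) [IsMarkovKernel κ] (p q : Measure Θ)
    [IsProbabilityMeasure p] [IsProbabilityMeasure q] (hqp : q ≪ p)
    (hfin : EIGaff κ q p ≠ ⊤) :
    EIGaff κ q p = EIG κ q + klDiv (marg κ q) (marg κ p) ∧
    EIGaff κ p p = EIG κ p := by
  refine ⟨?_, rfl⟩
  have : IsProbabilityMeasure (marg κ q) := inferInstanceAs (IsProbabilityMeasure (q.bind κ))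
  have : IsProbabilityMeasure (marg κ p) := inferInstanceAs (IsProbabilityMeasure (p.bind κ))
  have hac : marg κ q ≪ marg κ p := hqp.comp_right κ
  have hmeas := measurable_llr (marg κ q) (marg κ p)
  have hneg : Measurable fun y ↦ -llr (marg κ q) (marg κ p) y := hmeas.neg
  have hpos : ∀ᵐ θ ∂q, ∀ᵐ y ∂κ θ, (marg κ q).rnDeriv (marg κ p) y ≠ 0 :=
    Measure.ae_ae_of_ae_comp ((Measure.rnDeriv_pos hac).mono fun _ h ↦ h.ne')
  have hmarg {f : 𝒴 → ℝ≥0∞} (hf : Measurable f) :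
      ∫⁻ y, f y ∂marg κ q = ∫⁻ θ, ∫⁻ y, f y ∂κ θ ∂q :=
    Measure.lintegral_bind κ.aemeasurable hf.aemeasurable
  refine (ENNReal.add_left_inj (lintegral_ofReal_neg_llr_ne_top _ _ hac)).mp ?_
  rw [add_assoc, klDiv_add_lintegral_ofReal_neg_llr _ _ hac, hmarg hneg.ennreal_ofReal,
    hmarg hmeas.ennreal_ofReal, EIGaff, EIG,
    ← lintegral_add_right _ hneg.ennreal_ofReal.lintegral_kernel,
    ← lintegral_add_right _ hmeas.ennreal_ofReal.lintegral_kernel]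
  exact lintegral_congr_ae (hpos.mono fun _ h ↦ klDiv_add_lintegral_ofReal_neg_llr_eq hac h)
end

section
/- Let Θ and 𝒴 be measurable spaces, κ a Markov kernel from Θ to 𝒴, p a probability measure on Θ, and ε ≥ 0. Let A_ε(p) be the set of probability measures q on Θ with q ≪ p and KL(q ‖ p) ≤ ε, and define the robust expected information gain I_ε(p) = inf over q ∈ A_ε(p) of I_aff(q;p) and the true robust expected information gain I_ε^true(p) = inf over q ∈ A_ε(p) of I(q). Then I(p) ≥ I_ε(p) ≥ I_ε^true(p). -/
open MeasureTheory ProbabilityTheory Real Classical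
open scoped ENNReal

/-- The negative part of the log-likelihood ratio is always integrable. -/
lemma lintegral_neg_llr_ne_top {α : Type*} [MeasurableSpace α] {μ ν : Measure α}
    [IsProbabilityMeasure μ] [IsProbabilityMeasure ν] (h : μ ≪ ν) :
    ∫⁻ x, ENNReal.ofReal (-llr μ ν x) ∂μ ≠ ⊤ := by
  have hle : ∫⁻ x, ENNReal.ofReal (-llr μ ν x) ∂μ ≤ ∫⁻ _, 1 ∂ν := by
    have hm := measurable_llr μ ν
    rw [← lintegral_rnDeriv_mul h (by fun_prop)]
    refine lintegral_mono_ae ?_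
    filter_upwards [Measure.rnDeriv_ne_top μ ν] with x hx
    rw [← ENNReal.ofReal_toReal hx, ← ENNReal.ofReal_mul ENNReal.toReal_nonneg,
      ENNReal.ofReal_le_one]
    have hk := InformationTheory.klFun_nonneg (ENNReal.toReal_nonneg (a := μ.rnDeriv ν x))
    rw [InformationTheory.klFun_apply] at hk
    have h0 : 0 ≤ (μ.rnDeriv ν x).toReal := ENNReal.toReal_nonneg
    simp only [llr_def]
    linarith
  exact ne_top_of_le_ne_top (by simp) hle

lemma klDiv_add_lintegral_neg_llr {α : Type*} [MeasurableSpace α] {μ ν : Measure α}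
    [IsProbabilityMeasure μ] [IsProbabilityMeasure ν] (h : μ ≪ ν) :
    klDiv μ ν + ∫⁻ x, ENNReal.ofReal (-llr μ ν x) ∂μ = ∫⁻ x, ENNReal.ofReal (llr μ ν x) ∂μ := by
  have hneg := lintegral_neg_llr_ne_top h
  by_cases hint : Integrable (llr μ ν) μ
  · have hpos : ∫⁻ x, ENNReal.ofReal (llr μ ν x) ∂μ ≠ ⊤ := by
      refine ne_top_of_le_ne_top hint.2.ne (lintegral_mono fun x ↦ ?_)
      rw [← ofReal_norm]
      exact ENNReal.ofReal_le_ofReal (le_abs_self _)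
    have hnonneg : 0 ≤ ∫ x, llr μ ν x ∂μ := by
      simpa using InformationTheory.integral_llr_add_sub_measure_univ_nonneg h hint
    rw [klDiv, if_pos ⟨h, hint⟩]
    nth_rewrite 1 [← ENNReal.ofReal_toReal hneg]
    rw [← ENNReal.ofReal_add hnonneg ENNReal.toReal_nonneg,
      integral_eq_lintegral_pos_part_sub_lintegral_neg_part hint, sub_add_cancel,
      ENNReal.ofReal_toReal hpos]
  · have hpos : ∫⁻ x, ENNReal.ofReal (llr μ ν x) ∂μ = ⊤ := by
      by_contra hne
      refine hint ⟨(measurable_llr μ ν).aestronglyMeasurable, ?_⟩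
      refine lt_of_le_of_lt (lintegral_mono fun x ↦ ?_)
        (b := ∫⁻ x, (ENNReal.ofReal (llr μ ν x) + ENNReal.ofReal (-llr μ ν x)) ∂μ) ?_
      · rw [← ofReal_norm, Real.norm_eq_abs]
        rcases abs_choice (llr μ ν x) with hx | hx <;> rw [hx] <;> simp
      · rw [lintegral_add_left (measurable_llr μ ν).ennreal_ofReal]
        exact ENNReal.add_lt_top.2 ⟨Ne.lt_top hne, hneg.lt_top⟩
    rw [klDiv, if_neg fun hc ↦ hint hc.2, hpos, top_add]

lemma klDiv_self_eq_zero {α : Type*} [MeasurableSpace α] (μ : Measure α) [SigmaFinite μ] :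
    klDiv μ μ = 0 := by
  have h := llr_self μ
  rw [klDiv]
  split_ifs with hc
  · simp [integral_congr_ae h]
  · exact (hc ⟨Measure.AbsolutelyContinuous.rfl,
      (integrable_congr h).2 (integrable_zero _ _ μ)⟩).elim

/-- Chain rule for a change of reference measure, with the integral of `llr ν ρ` split into its
positive and negative parts. -/
lemma klDiv_add_lintegral_llr {α : Type*} [MeasurableSpace α] {μ ν ρ : Measure α}
    [IsProbabilityMeasure μ] [IsProbabilityMeasure ν] [IsProbabilityMeasure ρ]
    (hμν : μ ≪ ν) (hνρ : ν ≪ ρ) :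
    klDiv μ ν + ∫⁻ x, ENNReal.ofReal (llr ν ρ x) ∂μ =
      klDiv μ ρ + ∫⁻ x, ENNReal.ofReal (-llr ν ρ x) ∂μ := by
  have hμρ := hμν.trans hνρ
  have hllr : ∀ᵐ x ∂μ, llr μ ν x + llr ν ρ x = llr μ ρ x := by
    filter_upwards [hμρ.ae_le (Measure.rnDeriv_mul_rnDeriv (κ := ρ) hμν),
      Measure.rnDeriv_pos hμν, hμν.ae_le (Measure.rnDeriv_pos hνρ),
      hμν.ae_le (Measure.rnDeriv_ne_top μ ν), hμρ.ae_le (Measure.rnDeriv_ne_top ν ρ)]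
      with x hx h1 h2 h3 h4
    simp only [llr_def]
    rw [← Real.log_mul (ENNReal.toReal_pos h1.ne' h3).ne' (ENNReal.toReal_pos h2.ne' h4).ne',
      ← ENNReal.toReal_mul, ← hx, Pi.mul_apply]
  have hparts : ∫⁻ x, ENNReal.ofReal (llr μ ν x) ∂μ + ∫⁻ x, ENNReal.ofReal (llr ν ρ x) ∂μ
        + ∫⁻ x, ENNReal.ofReal (-llr μ ρ x) ∂μ =
      ∫⁻ x, ENNReal.ofReal (-llr μ ν x) ∂μ + ∫⁻ x, ENNReal.ofReal (-llr ν ρ x) ∂μ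
        + ∫⁻ x, ENNReal.ofReal (llr μ ρ x) ∂μ := by
    have m1 := measurable_llr μ ν
    have m2 := measurable_llr ν ρ
    rw [← lintegral_add_left (by fun_prop), ← lintegral_add_left (by fun_prop),
      ← lintegral_add_left (by fun_prop), ← lintegral_add_left (by fun_prop)]
    refine lintegral_congr_ae ?_
    filter_upwards [hllr] with x hx
    rw [← hx]
    simp only [ENNReal.ofReal]
    norm_cast
    rw [← NNReal.coe_inj]
    push_cast
    simp only [Real.coe_toNNReal']
    grind
  rw [← klDiv_add_lintegral_neg_llr hμν, ← klDiv_add_lintegral_neg_llr hμρ] at hparts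
  have hfin := ENNReal.add_ne_top.2
    ⟨lintegral_neg_llr_ne_top hμν, lintegral_neg_llr_ne_top hμρ⟩
  refine (ENNReal.add_left_inj hfin).1 ?_
  calc _ = _ := by ring
    _ = _ := hparts
    _ = _ := by ring

lemma absolutelyContinuous_of_rnDeriv_ne_zero {α : Type*} [MeasurableSpace α]
    {μ ν ρ : Measure α} [SigmaFinite ν] [SigmaFinite ρ] (hμρ : μ ≪ ρ) (hνρ : ν ≪ ρ)
    (h : ∀ᵐ x ∂μ, ν.rnDeriv ρ x ≠ 0) : μ ≪ ν := by
  intro s hs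
  rw [← Measure.withDensity_rnDeriv_eq ν ρ hνρ,
    withDensity_apply_eq_zero (Measure.measurable_rnDeriv ν ρ)] at hs
  exact (Measure.measure_inter_eq_of_ae h).symm.trans (hμρ hs)

/-- The expected information gain is dominated by its affine approximation at any reference prior
which dominates the prior. No measurability of the divergence in the parameter is needed, since the
difference of the two integrands is measurable. -/
lemma EIG_le_EIGaff {Θ 𝒴 : Type*} [MeasurableSpace Θ] [MeasurableSpace 𝒴]
    (κ : Kernel Θ 𝒴) [IsMarkovKernel κ] {q p : Measure Θ} [IsProbabilityMeasure q]
    [IsProbabilityMeasure p] (hqp : q ≪ p) : EIG κ q ≤ EIGaff κ q p := by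
  have : IsProbabilityMeasure (marg κ q) := by unfold marg; infer_instance
  have : IsProbabilityMeasure (marg κ p) := by unfold marg; infer_instance
  have hmarg : marg κ q ≪ marg κ p := hqp.comp_right κ
  have hllr := measurable_llr (marg κ q) (marg κ p)
  have hmix (f : 𝒴 → ℝ≥0∞) (hf : Measurable f) :
      ∫⁻ θ, ∫⁻ y, f y ∂κ θ ∂q = ∫⁻ y, f y ∂marg κ q :=
    (Measure.lintegral_bind κ.measurable.aemeasurable hf.aemeasurable).symm
  have hne : ∀ᵐ θ ∂q, ∀ᵐ y ∂κ θ, (marg κ q).rnDeriv (marg κ p) y ≠ 0 := by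
    refine Measure.ae_ae_of_ae_bind κ.measurable.aemeasurable ?_
    filter_upwards [Measure.rnDeriv_pos hmarg] with y hy using hy.ne'
  have hpt : ∀ᵐ θ ∂q, klDiv (κ θ) (marg κ q)
        + ∫⁻ y, ENNReal.ofReal (llr (marg κ q) (marg κ p) y) ∂κ θ ≤
      klDiv (κ θ) (marg κ p)
        + ∫⁻ y, ENNReal.ofReal (-llr (marg κ q) (marg κ p) y) ∂κ θ := by
    filter_upwards [hne] with θ hθ
    by_cases hac : κ θ ≪ marg κ p
    · exact (klDiv_add_lintegral_llr
        (absolutelyContinuous_of_rnDeriv_ne_zero hac hmarg hθ) hmarg).le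
    · rw [klDiv, klDiv, if_neg fun hc : κ θ ≪ marg κ p ∧ _ ↦ hac hc.1, top_add]
      exact le_top
  have hint := lintegral_mono_ae hpt
  rw [lintegral_add_right _ (by fun_prop), lintegral_add_right _ (by fun_prop),
    hmix _ (by fun_prop), hmix _ (by fun_prop), ← klDiv_add_lintegral_neg_llr hmarg,
    ← add_assoc] at hint
  exact le_self_add.trans
    ((ENNReal.add_le_add_iff_right (lintegral_neg_llr_ne_top hmarg)).1 hint)

/-- Sandwich between EIG, robust EIG and true robust EIG:
`I(p) ≥ I_ε(p) ≥ I_ε^true(p)`, where `I_ε(p) = inf_{q ∈ A_ε(p)} I_aff(q;p)` and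
`I_ε^true(p) = inf_{q ∈ A_ε(p)} I(q)` over the KL ambiguity set
`A_ε(p) = {q : q ≪ p, KL(q‖p) ≤ ε}`. -/
theorem eig_ge_reig_ge_true_reig
    {Θ 𝒴 : Type*} [MeasurableSpace Θ] [MeasurableSpace 𝒴]
    (κ : Kernel Θ 𝒴) [IsMarkovKernel κ] (p : Measure Θ) [IsProbabilityMeasure p]
    (ε : ℝ) (hε : 0 ≤ ε) :
    EIG κ p ≥
      sInf {r : ℝ≥0∞ | ∃ q : Measure Θ, IsProbabilityMeasure q ∧ q ≪ p ∧
        klDiv q p ≤ ENNReal.ofReal ε ∧ r = EIGaff κ q p} ∧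
    sInf {r : ℝ≥0∞ | ∃ q : Measure Θ, IsProbabilityMeasure q ∧ q ≪ p ∧
        klDiv q p ≤ ENNReal.ofReal ε ∧ r = EIGaff κ q p} ≥
      sInf {r : ℝ≥0∞ | ∃ q : Measure Θ, IsProbabilityMeasure q ∧ q ≪ p ∧
        klDiv q p ≤ ENNReal.ofReal ε ∧ r = EIG κ q} := by
  refine ⟨sInf_le ⟨p, inferInstance, Measure.AbsolutelyContinuous.rfl, ?_, rfl⟩, ?_⟩
  · rw [klDiv_self_eq_zero]
    exact zero_le
  · refine le_sInf ?_
    rintro _ ⟨q, hq, hqp, hkl, rfl⟩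
    exact sInf_le_of_le ⟨q, hq, hqp, hkl, rfl⟩ (EIG_le_EIGaff κ hqp)
end

section
/- Let N be a positive integer, d : Fin N → ℝ, and ε > 0. Let u denote the uniform probability vector (1/N, …, 1/N). Then the minimum of Σᵢ wᵢ·dᵢ over probability vectors w in the simplex of ℝᴺ satisfying KL(w ‖ u) = Σᵢ wᵢ·log(N·wᵢ) ≤ ε equals the negative of the infimum over λ > 0 of λ·ε + λ·log((1/N)·Σᵢ exp(−dᵢ/λ)). -/
open Real

theorem sum_exp_pos {N : ℕ} (hN : 0 < N) (x : Fin N → ℝ) : 0 < ∑ i, Real.exp (x i) :=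
  Finset.sum_pos (fun _ _ => Real.exp_pos _) ⟨⟨0, hN⟩, Finset.mem_univ _⟩

/-- Gibbs' variational inequality for the uniform distribution on `Fin N`. -/
theorem sum_mul_le_kl_uniform_add_log (N : ℕ) (hN : 0 < N) (x w : Fin N → ℝ)
    (hw : ∀ i, 0 ≤ w i) (hw1 : ∑ i, w i = 1) :
    ∑ i, w i * x i ≤
      ∑ i, w i * Real.log (N * w i) + Real.log ((1 / N) * ∑ i, Real.exp (x i)) := by
  have hN' : (0 : ℝ) < N := by exact_mod_cast hN
  have hS := sum_exp_pos hN x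
  have hterm : ∀ i, w i * x i - w i * Real.log (N * w i)
      - w i * Real.log ((1 / N) * ∑ j, Real.exp (x j))
      ≤ Real.exp (x i) / (∑ j, Real.exp (x j)) - w i := by
    intro i
    rcases (hw i).eq_or_lt with h | h
    · rw [← h]
      have := div_nonneg (Real.exp_pos (x i)).le hS.le
      simpa using this
    · have hlog := Real.log_le_sub_one_of_pos
        (div_pos (div_pos (Real.exp_pos (x i)) hS) h)
      rw [Real.log_div (div_pos (Real.exp_pos _) hS).ne' h.ne',
        Real.log_div (Real.exp_pos _).ne' hS.ne', Real.log_exp] at hlog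
      rw [Real.log_mul hN'.ne' h.ne', Real.log_mul (by positivity) hS.ne', one_div,
        Real.log_inv]
      have hmul := mul_le_mul_of_nonneg_left hlog h.le
      have hcancel : w i * (Real.exp (x i) / (∑ j, Real.exp (x j)) / w i - 1)
          = Real.exp (x i) / (∑ j, Real.exp (x j)) - w i := by
        field_simp
      linarith
  have hsum := Finset.sum_le_sum fun i (_ : i ∈ Finset.univ) => hterm i
  simp only [Finset.sum_sub_distrib, ← Finset.sum_mul, ← Finset.sum_div, hw1,
    div_self hS.ne'] at hsum
  linarith

/-- The probability vector proportional to `exp ∘ x`. -/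
noncomputable def gibbsWeight {N : ℕ} (x : Fin N → ℝ) (i : Fin N) : ℝ :=
  Real.exp (x i) / ∑ j, Real.exp (x j)

theorem gibbsWeight_nonneg {N : ℕ} (x : Fin N → ℝ) (i : Fin N) : 0 ≤ gibbsWeight x i :=
  div_nonneg (Real.exp_pos _).le (Finset.sum_nonneg fun _ _ => (Real.exp_pos _).le)

theorem sum_gibbsWeight {N : ℕ} (hN : 0 < N) (x : Fin N → ℝ) :
    ∑ i, gibbsWeight x i = 1 := by
  simp only [gibbsWeight, ← Finset.sum_div, div_self (sum_exp_pos hN x).ne']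

/-- Gibbs weights attain equality in the variational inequality. -/
theorem kl_gibbsWeight {N : ℕ} (hN : 0 < N) (x : Fin N → ℝ) :
    ∑ i, gibbsWeight x i * Real.log (N * gibbsWeight x i) =
      ∑ i, gibbsWeight x i * x i - Real.log ((1 / N) * ∑ i, Real.exp (x i)) := by
  have hN' : (0 : ℝ) < N := by exact_mod_cast hN
  have hS := sum_exp_pos hN x
  have hlog : ∀ i, Real.log (N * gibbsWeight x i) =
      x i - Real.log ((1 / N) * ∑ i, Real.exp (x i)) := by
    intro i
    rw [gibbsWeight, Real.log_mul hN'.ne' (div_pos (Real.exp_pos _) hS).ne',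
      Real.log_div (Real.exp_pos _).ne' hS.ne', Real.log_exp,
      Real.log_mul (by positivity) hS.ne', one_div, Real.log_inv]
    ring
  simp only [hlog, mul_sub, Finset.sum_sub_distrib, ← Finset.sum_mul,
    sum_gibbsWeight hN, one_mul]

theorem kl_uniform_nonneg {N : ℕ} (hN : 0 < N) (w : Fin N → ℝ)
    (hw : ∀ i, 0 ≤ w i) (hw1 : ∑ i, w i = 1) :
    0 ≤ ∑ i, w i * Real.log (N * w i) := by
  have hN' : (N : ℝ) ≠ 0 := by exact_mod_cast hN.ne'
  simpa [hN'] using sum_mul_le_kl_uniform_add_log N hN (fun _ => 0) w hw hw1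

theorem kl_gibbsWeight_le {N : ℕ} (hN : 0 < N) (x : Fin N → ℝ) (c : ℝ)
    (hx : ∀ i, |x i| ≤ c) :
    ∑ i, gibbsWeight x i * Real.log (N * gibbsWeight x i) ≤ 2 * c := by
  have hN' : (0 : ℝ) < N := by exact_mod_cast hN
  have hmean : ∑ i, gibbsWeight x i * x i ≤ c :=
    calc ∑ i, gibbsWeight x i * x i ≤ ∑ i, gibbsWeight x i * c :=
          Finset.sum_le_sum fun i _ =>
            mul_le_mul_of_nonneg_left (abs_le.1 (hx i)).2 (gibbsWeight_nonneg x i)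
      _ = c := by rw [← Finset.sum_mul, sum_gibbsWeight hN, one_mul]
  have hlog : -c ≤ Real.log ((1 / N) * ∑ i, Real.exp (x i)) := by
    have hS := sum_exp_pos hN x
    rw [Real.le_log_iff_exp_le (by positivity)]
    have h := Finset.sum_le_sum fun i (_ : i ∈ (Finset.univ : Finset (Fin N))) =>
      Real.exp_le_exp.2 (abs_le.1 (hx i)).1
    rw [Finset.sum_const, Finset.card_univ, Fintype.card_fin, nsmul_eq_mul] at h
    rw [one_div, inv_mul_eq_div, le_div_iff₀ hN']
    linarith
  rw [kl_gibbsWeight hN]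
  linarith

theorem continuousOn_kl_gibbsWeight {N : ℕ} (hN : 0 < N) (d : Fin N → ℝ) :
    ContinuousOn (fun l : ℝ => ∑ i, gibbsWeight (fun i => -(d i) / l) i *
      Real.log (N * gibbsWeight (fun i => -(d i) / l) i)) (Set.Ioi 0) := by
  have hN' : (0 : ℝ) < N := by exact_mod_cast hN
  have hx : ∀ i, ContinuousOn (fun l : ℝ => -(d i) / l) (Set.Ioi 0) := fun i =>
    continuousOn_const.div continuousOn_id fun l hl => (Set.mem_Ioi.1 hl).ne'
  have hw : ∀ i, ContinuousOn (fun l : ℝ => gibbsWeight (fun i => -(d i) / l) i)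
      (Set.Ioi 0) := fun i =>
    (hx i).rexp.div (continuousOn_finsetSum _ fun j _ => (hx j).rexp)
      fun l _ => (sum_exp_pos hN _).ne'
  refine continuousOn_finsetSum _ fun i _ => (hw i).mul ?_
  refine (continuousOn_const.mul (hw i)).log fun l _ => ?_
  exact (mul_pos hN' (div_pos (Real.exp_pos _) (sum_exp_pos hN _))).ne'

/-- There are multipliers whose Gibbs weights are feasible and almost satisfy complementary
slackness. -/
theorem exists_gibbsWeight_kl_le {N : ℕ} (hN : 0 < N) (d : Fin N → ℝ) {ε δ : ℝ}
    (hε : 0 < ε) (hδ : 0 < δ) :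
    ∃ l : ℝ, 0 < l ∧
      ∑ i, gibbsWeight (fun i => -(d i) / l) i *
        Real.log (N * gibbsWeight (fun i => -(d i) / l) i) ≤ ε ∧
      l * (ε - ∑ i, gibbsWeight (fun i => -(d i) / l) i *
        Real.log (N * gibbsWeight (fun i => -(d i) / l) i)) ≤ δ := by
  set K : ℝ → ℝ := fun l => ∑ i, gibbsWeight (fun i => -(d i) / l) i *
      Real.log (N * gibbsWeight (fun i => -(d i) / l) i) with hK
  change ∃ l : ℝ, 0 < l ∧ K l ≤ ε ∧ l * (ε - K l) ≤ δ
  have hl₀ : 0 < δ / ε := div_pos hδ hε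
  by_cases h₀ : K (δ / ε) ≤ ε
  · refine ⟨δ / ε, hl₀, h₀, ?_⟩
    have hnn : 0 ≤ K (δ / ε) :=
      kl_uniform_nonneg hN _ (gibbsWeight_nonneg _) (sum_gibbsWeight hN _)
    calc δ / ε * (ε - K (δ / ε)) ≤ δ / ε * ε :=
          mul_le_mul_of_nonneg_left (by linarith) hl₀.le
      _ = δ := div_mul_cancel₀ δ hε.ne'
  · obtain ⟨M, hM, hdM⟩ : ∃ M : ℝ, 0 < M ∧ ∀ i, |d i| ≤ M :=
      ⟨∑ i, |d i| + 1, by positivity, fun i => by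
        have := Finset.single_le_sum (f := fun i => |d i|)
          (fun i _ => abs_nonneg _) (Finset.mem_univ i)
        linarith⟩
    have hl₁ : 0 < 2 * M / ε := by positivity
    have h₁ : K (2 * M / ε) ≤ ε := by
      have h := kl_gibbsWeight_le hN (fun i => -(d i) / (2 * M / ε)) (ε / 2) fun i => by
        rw [abs_div, abs_neg, abs_of_pos hl₁, div_le_iff₀ hl₁]
        have : ε / 2 * (2 * M / ε) = M := by field_simp
        rw [this]
        exact hdM i
      simp only [hK]
      linarith
    obtain ⟨l, hl, hKl⟩ := isPreconnected_Ioi.intermediate_value (Set.mem_Ioi.2 hl₁)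
      (Set.mem_Ioi.2 hl₀) (continuousOn_kl_gibbsWeight hN d) ⟨h₁, (not_le.1 h₀).le⟩
    change K l = ε at hKl
    exact ⟨l, hl, hKl.le, by rw [hKl, sub_self, mul_zero]; exact hδ.le⟩

theorem mul_sum_mul_neg_div {N : ℕ} (w d : Fin N → ℝ) {l : ℝ} (hl : l ≠ 0) :
    l * ∑ i, w i * (-(d i) / l) = -∑ i, w i * d i := by
  rw [Finset.mul_sum, ← Finset.sum_neg_distrib]
  refine Finset.sum_congr rfl fun i _ => ?_
  field_simp

/-- Discrete (sample-average-approximation) form of the KL-ambiguity-set duality: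
the minimum of `Σᵢ wᵢ dᵢ` over probability vectors `w` with
`KL(w ‖ uniform) = Σᵢ wᵢ log(N wᵢ) ≤ ε` equals
`− inf_{λ > 0} (λε + λ log((1/N) Σᵢ exp(−dᵢ/λ)))`. -/
theorem discrete_kl_ambiguity_duality (N : ℕ) (hN : 0 < N) (d : Fin N → ℝ)
    (ε : ℝ) (hε : 0 < ε) :
    sInf {r : ℝ | ∃ w : Fin N → ℝ, (∀ i, 0 ≤ w i) ∧ (∑ i, w i) = 1 ∧
        (∑ i, w i * Real.log (N * w i)) ≤ ε ∧ r = ∑ i, w i * d i} =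
    - sInf {r : ℝ | ∃ l : ℝ, 0 < l ∧
        r = l * ε + l * Real.log ((1 / N) * ∑ i, Real.exp (-(d i) / l))} := by
  set A := {r : ℝ | ∃ w : Fin N → ℝ, (∀ i, 0 ≤ w i) ∧ (∑ i, w i) = 1 ∧
        (∑ i, w i * Real.log (N * w i)) ≤ ε ∧ r = ∑ i, w i * d i}
  set B := {r : ℝ | ∃ l : ℝ, 0 < l ∧
        r = l * ε + l * Real.log ((1 / N) * ∑ i, Real.exp (-(d i) / l))}
  have weak : ∀ a ∈ A, ∀ b ∈ B, -b ≤ a := by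
    rintro _ ⟨w, hw, hw1, hKL, rfl⟩ _ ⟨l, hl, rfl⟩
    have h := mul_le_mul_of_nonneg_left
      (sum_mul_le_kl_uniform_add_log N hN (fun i => -(d i) / l) w hw hw1) hl.le
    rw [mul_sum_mul_neg_div w d hl.ne', mul_add] at h
    have := mul_le_mul_of_nonneg_left hKL hl.le
    linarith
  have strong : ∀ δ > 0, ∃ a ∈ A, ∃ b ∈ B, a ≤ -b + δ := by
    intro δ hδ
    obtain ⟨l, hl, hKL, hgap⟩ := exists_gibbsWeight_kl_le hN d hε hδ
    refine ⟨_, ⟨gibbsWeight fun i => -(d i) / l, gibbsWeight_nonneg _,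
      sum_gibbsWeight hN _, hKL, rfl⟩, _, ⟨l, hl, rfl⟩, ?_⟩
    rw [kl_gibbsWeight hN, mul_sub, mul_sub, mul_sum_mul_neg_div _ d hl.ne'] at hgap
    linarith
  obtain ⟨a₀, ha₀, b₀, hb₀, -⟩ := strong 1 one_pos
  apply le_antisymm
  · refine le_of_forall_pos_le_add fun δ hδ => ?_
    obtain ⟨a, ha, b, hb, hab⟩ := strong δ hδ
    have h₁ : sInf A ≤ a := csInf_le ⟨-b₀, fun a ha => weak a ha b₀ hb₀⟩ ha
    have h₂ : sInf B ≤ b := csInf_le ⟨-a₀, fun b hb => neg_le.1 (weak a₀ ha₀ b hb)⟩ hb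
    linarith
  · exact le_csInf ⟨a₀, ha₀⟩ fun a ha =>
      neg_le.1 (le_csInf ⟨b₀, hb₀⟩ fun b hb => neg_le.1 (weak a ha b hb))
end
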